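/- arXiv:1304.5328 — 3 statements merged into one kernel-verified Lean document; each statement's English description precedes it below -/
import Mathlib

section
/- For every natural number d ≥ 2, the integral ∫_0^∞ (sin x / x)^d dx is strictly positive. -/
open MeasureTheory Filter Topology

/-- Powers `d ≥ 2` of the cardinal sine are Lebesgue integrable on the real line. -/
theorem integrable_sinc_pow {d : ℕ} (hd : 2 ≤ d) : Integrable fun x : ℝ => Real.sinc x ^ d := by
  refine (integrable_inv_one_add_sq.const_mul 2).mono'
    (Real.continuous_sinc.pow d).aestronglyMeasurable (ae_of_all _ fun x => ?_)
  have h1 : |Real.sinc x| ≤ 1 := Real.abs_sinc_le_one x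
  have h2 : x * Real.sinc x = Real.sin x := by
    rcases eq_or_ne x 0 with rfl | hx
    · simp
    · rw [Real.sinc_of_ne_zero hx]; field_simp
  have h3 : Real.sinc x ^ 2 ≤ 1 := (sq_le_one_iff_abs_le_one _).2 h1
  have h4 : (x * Real.sinc x) ^ 2 ≤ 1 := by rw [h2]; exact Real.sin_sq_le_one x
  calc ‖Real.sinc x ^ d‖ = |Real.sinc x| ^ d := by rw [Real.norm_eq_abs, abs_pow]
    _ ≤ |Real.sinc x| ^ 2 := pow_le_pow_of_le_one (abs_nonneg _) h1 hd
    _ = Real.sinc x ^ 2 := sq_abs _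
    _ ≤ 2 * (1 + x ^ 2)⁻¹ := by
      rw [← div_eq_mul_inv, le_div_iff₀ (by positivity)]
      nlinarith

/-- On each period, the positive half-wave of the sine outweighs the half-wave that follows it. -/
theorem integral_sinc_pow_period_pos {d : ℕ} (hd : d ≠ 0) (n : ℕ) :
    0 < ∫ x in (n * (2 * Real.pi))..((n + 1 : ℕ) * (2 * Real.pi)), Real.sinc x ^ d := by
  have hc : Continuous fun x : ℝ => Real.sinc x ^ d := Real.continuous_sinc.pow d
  have hshift (c : ℝ) : Continuous fun x : ℝ => Real.sinc (x + c) ^ d :=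
    hc.comp (continuous_add_const c)
  have hπ := Real.pi_pos
  set a : ℝ := n * (2 * Real.pi) with ha
  have ha0 : 0 ≤ a := by positivity
  have hb : ((n + 1 : ℕ) : ℝ) * (2 * Real.pi) = Real.pi + (a + Real.pi) := by
    rw [ha]; push_cast; ring
  have hsplit : ∫ x in a..(Real.pi + (a + Real.pi)), Real.sinc x ^ d =
      ∫ x in (0 : ℝ)..Real.pi, (Real.sinc (x + a) ^ d + Real.sinc (x + (a + Real.pi)) ^ d) := by
    rw [intervalIntegral.integral_add
      ((hshift a).intervalIntegrable _ _)
      ((hshift (a + Real.pi)).intervalIntegrable _ _),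
      intervalIntegral.integral_comp_add_right (fun x => Real.sinc x ^ d),
      intervalIntegral.integral_comp_add_right (fun x => Real.sinc x ^ d),
      zero_add, zero_add, add_comm Real.pi a,
      intervalIntegral.integral_add_adjacent_intervals
        (hc.intervalIntegrable _ _) (hc.intervalIntegrable _ _)]
  rw [hb, hsplit]
  refine intervalIntegral.intervalIntegral_pos_of_pos_on
    (Continuous.intervalIntegrable ((hshift a).add (hshift (a + Real.pi))) _ _) (fun x hx => ?_) hπ
  have hs : 0 < Real.sin x := Real.sin_pos_of_mem_Ioo hx
  have hx0 : 0 < x := hx.1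
  have h1 : Real.sinc (x + a) = Real.sin x / (x + a) := by
    rw [Real.sinc_of_ne_zero (by positivity), ha, Real.sin_add_nat_mul_two_pi]
  have h2 : |Real.sinc (x + (a + Real.pi))| = Real.sin x / (x + (a + Real.pi)) := by
    rw [Real.sinc_of_ne_zero (by positivity), ← add_assoc, Real.sin_add_pi, ha,
      Real.sin_add_nat_mul_two_pi, abs_div, abs_neg, abs_of_pos hs, abs_of_pos (by positivity)]
  have h3 : |Real.sinc (x + (a + Real.pi))| < Real.sinc (x + a) := by
    rw [h1, h2]
    exact div_lt_div_of_pos_left hs (by positivity) (by linarith)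
  have h4 := pow_lt_pow_left₀ h3 (abs_nonneg _) hd
  rw [← abs_pow] at h4
  linarith [neg_abs_le (Real.sinc (x + (a + Real.pi)) ^ d)]

/-- For every natural number `d ≥ 2`, the Lebesgue integral
`∫_0^∞ (sin x / x)^d dx` is strictly positive. -/
theorem sinc_pow_integral_pos (d : ℕ) (hd : 2 ≤ d) :
    0 < ∫ x in Set.Ioi (0 : ℝ), (Real.sin x / x) ^ d := by
  have hd0 : d ≠ 0 := by lia
  have hI := integrable_sinc_pow hd
  have hcongr : ∫ x in Set.Ioi (0 : ℝ), (Real.sin x / x) ^ d =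
      ∫ x in Set.Ioi (0 : ℝ), Real.sinc x ^ d :=
    setIntegral_congr_fun measurableSet_Ioi fun x hx => by
      simp only [Real.sinc_of_ne_zero (ne_of_gt (Set.mem_Ioi.1 hx))]
  rw [hcongr]
  have hlim : Tendsto (fun n : ℕ => ∫ x in (0 : ℝ)..(n * (2 * Real.pi)), Real.sinc x ^ d) atTop
      (𝓝 (∫ x in Set.Ioi (0 : ℝ), Real.sinc x ^ d)) :=
    intervalIntegral_tendsto_integral_Ioi 0 hI.integrableOn
      (tendsto_natCast_atTop_atTop.atTop_mul_const Real.two_pi_pos)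
  have hmono : StrictMono fun n : ℕ => ∫ x in (0 : ℝ)..(n * (2 * Real.pi)), Real.sinc x ^ d :=
    strictMono_nat_of_lt_succ fun n => by
      rw [← intervalIntegral.integral_add_adjacent_intervals
        (hI.intervalIntegrable (a := 0) (b := n * (2 * Real.pi)))
        (hI.intervalIntegrable (b := (n + 1 : ℕ) * (2 * Real.pi)))]
      exact lt_add_of_pos_right _ (integral_sinc_pow_period_pos hd0 n)
  have h01 := hmono zero_lt_one
  have h1 := hmono.monotone.ge_of_tendsto hlim 1
  simp only [Nat.cast_zero, zero_mul, intervalIntegral.integral_same] at h01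
  exact h01.trans_le h1
end

section
/- The limit, as the natural number d tends to infinity, of d^{1/2} · ∫_0^∞ (sin x / x)^d dx equals (6π)^{1/2} / 2. -/
open Filter Topology

/-- A quantitative bound on `sin x / x`, valid on the whole positive half-line. -/
lemma sq_sin_div_mul_one_add_le {x : ℝ} (hx : 0 < x) :
    (Real.sin x / x) ^ 2 * (1 + x ^ 2 / 26) ≤ 1 := by
  rw [div_pow, div_mul_eq_mul_div, div_le_one (by positivity)]
  rcases le_or_gt x 2 with h | h
  · have hs := Real.sin_bound (x := x / 2) (by rw [abs_of_pos (by positivity)]; linarith)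
    rw [abs_of_pos (by positivity : 0 < x / 2)] at hs
    have hs' := (abs_le.1 hs).2
    have h5 : (x / 2) ^ 5 ≤ (x / 2) ^ 3 :=
      pow_le_pow_of_le_one (by positivity) (by linarith) (by norm_num)
    have hpos : 0 ≤ Real.sin (x / 2) :=
      Real.sin_nonneg_of_nonneg_of_le_pi (by positivity) (by linarith [Real.pi_gt_three])
    have h3 : 2 * Real.sin (x / 2) ≤ x * (1 - x ^ 2 / 26) := by
      have : 0 < x ^ 3 := by positivity
      nlinarith
    have hsq : Real.sin x ^ 2 ≤ (x * (1 - x ^ 2 / 26)) ^ 2 := by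
      have hdouble : Real.sin x = 2 * Real.sin (x / 2) * Real.cos (x / 2) := by
        rw [← Real.sin_two_mul]; congr 1; ring
      calc Real.sin x ^ 2 = (2 * Real.sin (x / 2)) ^ 2 * Real.cos (x / 2) ^ 2 := by
            rw [hdouble]; ring
        _ ≤ (2 * Real.sin (x / 2)) ^ 2 * 1 := by
            gcongr; exact Real.cos_sq_le_one _
        _ ≤ (x * (1 - x ^ 2 / 26)) ^ 2 := by
            rw [mul_one]; gcongr
    have hu : x ^ 2 / 26 ≤ 1 := by nlinarith
    have hu0 : 0 ≤ x ^ 2 / 26 := by positivity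
    calc Real.sin x ^ 2 * (1 + x ^ 2 / 26)
        ≤ (x * (1 - x ^ 2 / 26)) ^ 2 * (1 + x ^ 2 / 26) := by gcongr
      _ = x ^ 2 * ((1 - x ^ 2 / 26) * (1 - (x ^ 2 / 26) ^ 2)) := by ring
      _ ≤ x ^ 2 * 1 := by
          gcongr
          exact mul_le_one₀ (by linarith) (by nlinarith) (by nlinarith)
      _ = x ^ 2 := mul_one _
  · have := Real.sin_sq_le_one x
    nlinarith [mul_le_of_le_one_left (by positivity : 0 ≤ 1 + x ^ 2 / 26) this]

lemma norm_sin_div_pow_le {d : ℕ} (hd : 2 ≤ d) {t : ℝ} (ht : 0 < t) :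
    ‖(Real.sin (t / √d) / (t / √d)) ^ d‖ ≤ (1 + (t / √78) ^ 2)⁻¹ := by
  have hd0 : (0 : ℝ) < d := by positivity
  have hx : 0 < t / √d := by positivity
  have hx2 : (t / √d) ^ 2 = t ^ 2 / d := by rw [div_pow, Real.sq_sqrt hd0.le]
  have hb := sq_sin_div_mul_one_add_le hx
  set s := Real.sin (t / √d) / (t / √d)
  rw [hx2] at hb
  have hs2 : s ^ 2 ≤ (1 + t ^ 2 / d / 26)⁻¹ := by
    rwa [← one_div, le_div_iff₀ (by positivity)]
  have hs1 : |s| ≤ 1 := by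
    rw [← sq_le_one_iff_abs_le_one]
    exact hs2.trans (inv_le_one_of_one_le₀ (le_add_of_nonneg_right (by positivity)))
  have hk : (d : ℝ) ≤ 3 * (d / 2 : ℕ) := by
    exact_mod_cast (by omega : d ≤ 3 * (d / 2))
  have hu : 0 ≤ t ^ 2 / d / 26 := by positivity
  rw [norm_pow, Real.norm_eq_abs, div_pow, Real.sq_sqrt (by norm_num)]
  calc |s| ^ d ≤ |s| ^ (2 * (d / 2)) :=
        pow_le_pow_of_le_one (abs_nonneg _) hs1 (by omega)
    _ = (s ^ 2) ^ (d / 2) := by rw [pow_mul, sq_abs]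
    _ ≤ ((1 + t ^ 2 / d / 26)⁻¹) ^ (d / 2) := by gcongr
    _ = ((1 + t ^ 2 / d / 26) ^ (d / 2))⁻¹ := inv_pow _ _
    _ ≤ (1 + t ^ 2 / 78)⁻¹ := by
        gcongr
        refine le_trans ?_ (one_add_mul_le_pow (by linarith) _)
        have : t ^ 2 / 78 = d / 3 * (t ^ 2 / d / 26) := by field_simp; norm_num
        rw [this]
        gcongr
        linarith

lemma tendsto_sin_div_pow {t : ℝ} (ht : 0 < t) :
    Tendsto (fun d : ℕ => (Real.sin (t / √d) / (t / √d)) ^ d) atTop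
      (𝓝 (Real.exp (-(1 / 6) * t ^ 2))) := by
  have key : Tendsto (fun d : ℕ => (d : ℝ) * (Real.sin (t / √d) / (t / √d) - 1)) atTop
      (𝓝 (-(1 / 6) * t ^ 2)) := by
    rw [tendsto_iff_norm_sub_tendsto_zero]
    refine squeeze_zero' (Eventually.of_forall fun _ => norm_nonneg _) ?_
      (tendsto_const_div_atTop_nhds_zero_nat (t ^ 4 / 100))
    filter_upwards [eventually_gt_atTop 0,
      tendsto_natCast_atTop_atTop.eventually_ge_atTop (t ^ 2)] with d hd hdt
    have hd0 : (0 : ℝ) < d := by positivity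
    have hx : 0 < t / √d := by positivity
    have hx2 : (t / √d) ^ 2 = t ^ 2 / d := by rw [div_pow, Real.sq_sqrt hd0.le]
    have hx1 : |t / √d| ≤ 1 := by
      rw [← sq_le_one_iff_abs_le_one, hx2]
      exact (div_le_one hd0).2 hdt
    have hs := Real.sin_bound hx1
    rw [abs_of_pos hx] at hs
    set x := t / √d
    have hdx : (d : ℝ) * x ^ 2 = t ^ 2 := by rw [hx2]; field_simp
    have heq : (d : ℝ) * (Real.sin x / x - 1) - -(1 / 6) * t ^ 2
        = d / x * (Real.sin x - (x - x ^ 3 / 6)) := by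
      rw [← hdx]; field_simp; ring
    rw [heq, norm_mul, Real.norm_eq_abs, Real.norm_eq_abs, abs_of_pos (by positivity)]
    calc d / x * |Real.sin x - (x - x ^ 3 / 6)| ≤ d / x * (x ^ 5 / 100) := by gcongr
      _ = d * (x ^ 2) ^ 2 / 100 := by field_simp
      _ = t ^ 4 / 100 / d := by rw [hx2]; field_simp
  simpa using Real.tendsto_one_add_pow_exp_of_tendsto key

/-- The limit, as the natural number `d` tends to infinity, of
`d^{1/2} · ∫_0^∞ (sin x / x)^d dx` equals `(6π)^{1/2} / 2`. -/
theorem sinc_pow_integral_asymptotics :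
    Tendsto
      (fun d : ℕ => Real.sqrt d * ∫ x in Set.Ioi (0 : ℝ), (Real.sin x / x) ^ d)
      atTop (𝓝 (Real.sqrt (6 * Real.pi) / 2)) := by
  have hlim : Tendsto
      (fun d : ℕ => ∫ t in Set.Ioi (0 : ℝ), (Real.sin (t / √d) / (t / √d)) ^ d) atTop
      (𝓝 (∫ t in Set.Ioi (0 : ℝ), Real.exp (-(1 / 6) * t ^ 2))) := by
    refine MeasureTheory.tendsto_integral_filter_of_dominated_convergence
      (fun t => (1 + (t / √78) ^ 2)⁻¹) ?_ ?_ ?_ ?_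
    · exact Eventually.of_forall fun d =>
        (by fun_prop : Measurable fun t : ℝ =>
          (Real.sin (t / √d) / (t / √d)) ^ d).aestronglyMeasurable
    · filter_upwards [eventually_ge_atTop 2] with d hd
      filter_upwards [MeasureTheory.ae_restrict_mem measurableSet_Ioi] with t ht
      exact norm_sin_div_pow_le hd ht
    · exact (integrable_inv_one_add_sq.comp_div (by positivity)).restrict
    · filter_upwards [MeasureTheory.ae_restrict_mem measurableSet_Ioi] with t ht
      exact tendsto_sin_div_pow ht
  rw [integral_gaussian_Ioi, show Real.pi / (1 / 6) = 6 * Real.pi by ring] at hlim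
  refine hlim.congr' ?_
  filter_upwards [eventually_gt_atTop 0] with d hd
  have hd0 : 0 < √(d : ℝ) := by positivity
  have h := MeasureTheory.integral_comp_mul_left_Ioi'
    (fun t : ℝ => (Real.sin (t / √d) / (t / √d)) ^ d) 0 hd0
  simpa [mul_div_cancel_left₀ _ hd0.ne'] using h.symm
end

section
/- The limit, as the natural number d tends to infinity, of d^{1/2} · ∫_0^{π/2} (sin x / x)^d dx equals (6π)^{1/2} / 2. -/
open Filter Topology

/-- A Gaussian upper bound for `sin x / x`. -/
lemma sin_div_self_le_exp_neg_sq {x : ℝ} (hx₀ : 0 < x) (hx : x ≤ 2 * Real.pi) :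
    Real.sin x / x ≤ Real.exp (-(1 / (2 * Real.pi ^ 2)) * x ^ 2) := by
  have hcos : Real.cos (x / 2) ≤ 1 - 2 / Real.pi ^ 2 * (x / 2) ^ 2 := by
    apply Real.cos_le_one_sub_mul_cos_sq
    rw [abs_of_pos (by positivity)]
    linarith
  have hexp := Real.add_one_le_exp (-(1 / (2 * Real.pi ^ 2)) * x ^ 2)
  have heq : 1 - 2 / Real.pi ^ 2 * (x / 2) ^ 2 = -(1 / (2 * Real.pi ^ 2)) * x ^ 2 + 1 := by
    ring
  have hsin : Real.sin (x / 2) ≤ x / 2 := Real.sin_le (by positivity)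
  have hsin₀ : 0 ≤ Real.sin (x / 2) :=
    Real.sin_nonneg_of_nonneg_of_le_pi (by positivity) (by linarith)
  have hdouble : Real.sin x = 2 * Real.sin (x / 2) * Real.cos (x / 2) := by
    rw [← Real.sin_two_mul]
    ring_nf
  rw [div_le_iff₀ hx₀, hdouble]
  have hle : Real.cos (x / 2) ≤ Real.exp (-(1 / (2 * Real.pi ^ 2)) * x ^ 2) := by linarith
  calc 2 * Real.sin (x / 2) * Real.cos (x / 2)
      ≤ 2 * Real.sin (x / 2) * Real.exp (-(1 / (2 * Real.pi ^ 2)) * x ^ 2) := by gcongr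
    _ ≤ 2 * (x / 2) * Real.exp (-(1 / (2 * Real.pi ^ 2)) * x ^ 2) := by gcongr
    _ = Real.exp (-(1 / (2 * Real.pi ^ 2)) * x ^ 2) * x := by ring

lemma abs_sin_div_self_sub_le {x : ℝ} (hx₀ : 0 < x) (hx : x ≤ 1) :
    |Real.sin x / x - 1 + x ^ 2 / 6| ≤ x ^ 4 / 100 := by
  have h := Real.sin_bound (x := x) (by rwa [abs_of_pos hx₀])
  rw [abs_of_pos hx₀] at h
  have heq : Real.sin x / x - 1 + x ^ 2 / 6 = (Real.sin x - (x - x ^ 3 / 6)) / x := by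
    field_simp
    ring
  rw [heq, abs_div, abs_of_pos hx₀, div_le_iff₀ hx₀]
  linarith

lemma tendsto_inv_sqrt_mul (y : ℝ) :
    Tendsto (fun d : ℕ => (Real.sqrt d)⁻¹ * y) atTop (𝓝 0) := by
  simpa using ((Real.tendsto_sqrt_atTop.comp
    tendsto_natCast_atTop_atTop).inv_tendsto_atTop.mul_const y)

lemma tendsto_sin_div_self_pow {y : ℝ} (hy : 0 < y) :
    Tendsto (fun d : ℕ => (Real.sin ((Real.sqrt d)⁻¹ * y) / ((Real.sqrt d)⁻¹ * y)) ^ d)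
      atTop (𝓝 (Real.exp (-(1 / 6) * y ^ 2))) := by
  have hlim : Tendsto (fun d : ℕ => (d : ℝ) *
      (Real.sin ((Real.sqrt d)⁻¹ * y) / ((Real.sqrt d)⁻¹ * y) - 1)) atTop
      (𝓝 (-(1 / 6) * y ^ 2)) := by
    have hbound : Tendsto (fun d : ℕ => y ^ 4 / 100 / (d : ℝ)) atTop (𝓝 0) :=
      tendsto_const_div_atTop_nhds_zero_nat _
    rw [tendsto_iff_dist_tendsto_zero]
    refine squeeze_zero' (Eventually.of_forall fun _ => dist_nonneg) ?_ hbound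
    filter_upwards [(tendsto_inv_sqrt_mul y).eventually_le_const one_pos, eventually_gt_atTop 0] with d h1 hd
    have hd' : (0 : ℝ) < d := by exact_mod_cast hd
    have hs : 0 < Real.sqrt d := Real.sqrt_pos.2 hd'
    have h := abs_sin_div_self_sub_le (x := (Real.sqrt d)⁻¹ * y) (by positivity) h1
    have hsq : ((Real.sqrt d)⁻¹ * y) ^ 2 = y ^ 2 / d := by
      rw [mul_pow, inv_pow, Real.sq_sqrt hd'.le]
      ring
    have hfour : ((Real.sqrt d)⁻¹ * y) ^ 4 = (y ^ 2 / d) ^ 2 := by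
      rw [← hsq]
      ring
    rw [hsq, hfour] at h
    generalize Real.sin ((Real.sqrt d)⁻¹ * y) / ((Real.sqrt d)⁻¹ * y) = s at h ⊢
    have heq : (d : ℝ) * (s - 1) - -(1 / 6) * y ^ 2 = d * (s - 1 + y ^ 2 / d / 6) := by
      field_simp
      ring
    rw [Real.dist_eq, heq, abs_mul, abs_of_pos hd']
    calc (d : ℝ) * |s - 1 + y ^ 2 / d / 6| ≤ d * ((y ^ 2 / d) ^ 2 / 100) := by gcongr
      _ = y ^ 4 / 100 / d := by field_simp
  simpa using Real.tendsto_one_add_pow_exp_of_tendsto hlim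

lemma sqrt_mul_setIntegral_Ioo_eq {d : ℕ} (hd : 0 < d) (f : ℝ → ℝ) (a : ℝ) :
    Real.sqrt d * ∫ x in Set.Ioo (0 : ℝ) a, f x =
      ∫ y in Set.Ioi (0 : ℝ), (Set.Iio a).indicator f ((Real.sqrt d)⁻¹ * y) := by
  have hs : 0 < Real.sqrt d := Real.sqrt_pos.2 (by exact_mod_cast hd)
  rw [MeasureTheory.integral_comp_mul_left_Ioi _ _ (inv_pos.2 hs), mul_zero, inv_inv,
    smul_eq_mul, MeasureTheory.setIntegral_indicator measurableSet_Iio, Set.Ioi_inter_Iio]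

/-- The limit, as the natural number `d` tends to infinity, of
`d^{1/2} · ∫_0^{π/2} (sin x / x)^d dx` equals `(6π)^{1/2} / 2`, where the
integral is the Lebesgue integral on `(0, π/2)`. -/
theorem sinc_pow_peak_integral_asymptotics :
    Tendsto
      (fun d : ℕ => Real.sqrt d * ∫ x in Set.Ioo (0 : ℝ) (Real.pi / 2),
        (Real.sin x / x) ^ d)
      atTop (𝓝 (Real.sqrt (6 * Real.pi) / 2)) := by
  have hpi := Real.pi_pos
  have hgauss : Real.sqrt (6 * Real.pi) / 2 =
      ∫ y in Set.Ioi (0 : ℝ), Real.exp (-(1 / 6) * y ^ 2) := by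
    rw [integral_gaussian_Ioi]
    congr 2
    ring
  rw [hgauss]
  have hscaled : (fun d : ℕ => ∫ y in Set.Ioi (0 : ℝ), (Set.Iio (Real.pi / 2)).indicator
      (fun x => (Real.sin x / x) ^ d) ((Real.sqrt d)⁻¹ * y)) =ᶠ[atTop]
      fun d : ℕ => Real.sqrt d * ∫ x in Set.Ioo (0 : ℝ) (Real.pi / 2),
        (Real.sin x / x) ^ d := by
    filter_upwards [eventually_gt_atTop 0] with d hd
    exact (sqrt_mul_setIntegral_Ioo_eq hd _ _).symm
  refine Tendsto.congr' hscaled ?_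
  refine MeasureTheory.tendsto_integral_filter_of_dominated_convergence
    (fun y => Real.exp (-(1 / (2 * Real.pi ^ 2)) * y ^ 2)) ?_ ?_ ?_ ?_
  · refine Eventually.of_forall fun d => Measurable.aestronglyMeasurable ?_
    exact (Measurable.indicator (by fun_prop) measurableSet_Iio).comp (by fun_prop)
  · filter_upwards [eventually_gt_atTop 0] with d hd
    filter_upwards [MeasureTheory.ae_restrict_mem measurableSet_Ioi] with y hy
    have hd' : (0 : ℝ) < d := by exact_mod_cast hd
    have hx : 0 < (Real.sqrt d)⁻¹ * y := mul_pos (inv_pos.2 (Real.sqrt_pos.2 hd')) hy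
    by_cases hlt : (Real.sqrt d)⁻¹ * y < Real.pi / 2
    · rw [Set.indicator_of_mem (Set.mem_Iio.2 hlt)]
      have hnonneg : 0 ≤ Real.sin ((Real.sqrt d)⁻¹ * y) / ((Real.sqrt d)⁻¹ * y) :=
        div_nonneg (Real.sin_nonneg_of_nonneg_of_le_pi hx.le (by linarith)) hx.le
      rw [Real.norm_of_nonneg (pow_nonneg hnonneg d)]
      refine (pow_le_pow_left₀ hnonneg
        (sin_div_self_le_exp_neg_sq hx (by linarith)) d).trans_eq ?_
      rw [← Real.exp_nat_mul, mul_pow, inv_pow, Real.sq_sqrt hd'.le]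
      congr 1
      field_simp
    · rw [Set.indicator_of_notMem (by simpa using hlt), norm_zero]
      positivity
  · exact (integrable_exp_neg_mul_sq (by positivity)).integrableOn
  · filter_upwards [MeasureTheory.ae_restrict_mem measurableSet_Ioi] with y hy
    refine (tendsto_sin_div_self_pow hy).congr' ?_
    filter_upwards [(tendsto_inv_sqrt_mul y).eventually_lt_const (half_pos hpi)] with d hd
    rw [Set.indicator_of_mem (Set.mem_Iio.2 hd)]
end
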